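/- arXiv:1706.02756 — 2 statements merged into one kernel-verified Lean document; each statement's English description precedes it below -/
import Mathlib

section
/- Let G be a finite group and N a normal subgroup of G such that the quotient group G/N is solvable. Let ω be an irreducible finite-dimensional complex representation of N with α(ω) = 1. Then the induced representation ω^G admits an irreducible component ρ (i.e., an irreducible G-representation ρ occurring with positive multiplicity in ω^G) satisfying α(ρ) = 1. -/
namespace AlphaChar

variable {G : Type*} [Group G] {V : Type*} [AddCommMonoid V] [Module ℂ V]

/-- The cardinality of the orbit of a vector `v` under the linear action of `G` via `ρ`. -/
noncomputable def orbitCard (ρ : Representation ℂ G V) (v : V) : ℕ :=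
  Nat.card (Set.range fun g : G => ρ g v)

open Classical in
/-- The α-characteristic of a representation: the gcd of the cardinalities of the orbits
of all nonzero vectors. -/
noncomputable def alphaChar [Finite G] (ρ : Representation ℂ G V) : ℕ :=
  ((Finset.range (Nat.card G + 1)).filter
    (fun n => ∃ v : V, v ≠ 0 ∧ orbitCard ρ v = n)).gcd id

/-- A representation is nontrivial if some group element acts as a non-identity operator. -/
def IsNontrivial (ρ : Representation ℂ G V) : Prop := ∃ g : G, ρ g ≠ 1

/-- A representation is irreducible if the space is nonzero and the only invariant
subspaces are `⊥` and `⊤`. -/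
def IsIrreducible (ρ : Representation ℂ G V) : Prop :=
  Nontrivial V ∧
    ∀ U : Submodule ℂ V, (∀ (g : G) (v : V), v ∈ U → ρ g v ∈ U) → U = ⊥ ∨ U = ⊤

end AlphaChar

namespace AlphaChar

variable {G : Type*} [Group G] (N : Subgroup G)
variable {W : Type*} [AddCommGroup W] [Module ℂ W]

/-- The space of the representation of `G` induced from a representation `θ` of a
subgroup `N`: functions `f : G → W` with `f (g * n) = θ n⁻¹ (f g)` (for finite groups
this coinduction model realizes the induced representation). -/
def inducedSpace (θ : Representation ℂ ↥N W) : Submodule ℂ (G → W) where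
  carrier := {f | ∀ (g : G) (n : ↥N), f (g * n) = θ n⁻¹ (f g)}
  zero_mem' := by intro g n; simp
  add_mem' := by
    intro a b ha hb g n
    simp only [Pi.add_apply, ha g n, hb g n, map_add]
  smul_mem' := by
    intro c f hf g n
    simp only [Pi.smul_apply, hf g n, map_smul]

/-- The representation of `G` induced from the representation `θ` of the subgroup `N`,
given by `(g · f) x = f (g⁻¹ * x)` on `inducedSpace N θ`. -/
def inducedRep (θ : Representation ℂ ↥N W) : Representation ℂ G ↥(inducedSpace N θ) where
  toFun g :=
    { toFun := fun f => ⟨fun x => f.1 (g⁻¹ * x), by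
        intro x n
        have := f.2 (g⁻¹ * x) n
        simpa [mul_assoc] using this⟩
      map_add' := by intro f₁ f₂; ext x; rfl
      map_smul' := by intro c f; ext x; rfl }
  map_one' := by ext f x; simp
  map_mul' := by
    intro a b
    ext f x
    simp [mul_assoc]

end AlphaChar

namespace AlphaChar

/-- The restriction of a representation to an invariant submodule. -/
def subRep {G : Type*} [Group G] {V : Type*} [AddCommGroup V] [Module ℂ V]
    (ρ : Representation ℂ G V) (U : Submodule ℂ V)
    (h : ∀ (g : G) (v : V), v ∈ U → ρ g v ∈ U) : Representation ℂ G ↥U where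
  toFun g := (ρ g).restrict (fun v hv => h g v hv)
  map_one' := by
    ext v
    simp [LinearMap.restrict_apply]
  map_mul' := by
    intro a b
    ext v
    simp [LinearMap.restrict_apply]

end AlphaChar

namespace AlphaChar

/-- Every subgroup of `G` of prime power order fixes some nonzero vector of `ρ`. -/
def PSubgroupsFix {G : Type*} [Group G] {V : Type*} [AddCommMonoid V] [Module ℂ V]
    (ρ : Representation ℂ G V) : Prop :=
  ∀ p : ℕ, p.Prime → ∀ P : Subgroup G, IsPGroup p P → ∃ v : V, v ≠ 0 ∧ ∀ x ∈ P, ρ x v = v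

section Characterization

variable {G : Type*} [Group G] {V : Type*} [AddCommMonoid V] [Module ℂ V]

theorem alphaChar_dvd_orbitCard [Finite G] (ρ : Representation ℂ G V) {v : V} (hv : v ≠ 0) :
    alphaChar ρ ∣ orbitCard ρ v := by
  classical
  refine Finset.gcd_dvd (f := id) (Finset.mem_filter.2 ⟨?_, v, hv, rfl⟩)
  exact Finset.mem_range.2 (Nat.lt_succ_of_le (Finite.card_range_le _))

theorem dvd_alphaChar [Finite G] (ρ : Representation ℂ G V) {d : ℕ}
    (h : ∀ v : V, v ≠ 0 → d ∣ orbitCard ρ v) : d ∣ alphaChar ρ := by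
  classical
  refine Finset.dvd_gcd fun n hn => ?_
  obtain ⟨-, v, hv, rfl⟩ := Finset.mem_filter.1 hn
  exact h v hv

theorem orbitCard_dvd_index (ρ : Representation ℂ G V) (P : Subgroup G) {v : V}
    (h : ∀ x ∈ P, ρ x v = v) : orbitCard ρ v ∣ P.index := by
  let _ : MulAction G V :=
    { smul := fun g w => ρ g w
      one_smul := fun w => by change ρ 1 w = w; simp
      mul_smul := fun a b w => by change ρ (a * b) w = ρ a (ρ b w); simp }
  have h1 : orbitCard ρ v = (MulAction.stabilizer G v).index :=
    (MulAction.index_stabilizer G v).symm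
  rw [h1]
  exact Subgroup.index_dvd_of_le fun x hx => h x hx

theorem exists_fixed_of_not_dvd_orbitCard (ρ : Representation ℂ G V) {p : ℕ} (hp : p.Prime)
    (P : Subgroup G) (hP : IsPGroup p P) {v : V} (hv : v ≠ 0) (h : ¬ p ∣ orbitCard ρ v) :
    ∃ w : V, w ≠ 0 ∧ ∀ x ∈ P, ρ x w = w := by
  have := Fact.mk hp
  let _ : MulAction P (Set.range fun g : G => ρ g v) :=
    { smul := fun x w => ⟨ρ x w.1, by
        obtain ⟨g, hg⟩ := w.2
        exact ⟨x * g, by simp [← hg]⟩⟩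
      one_smul := fun w => Subtype.ext (by change ρ ((1 : P) : G) w.1 = w.1; simp)
      mul_smul := fun a b w => Subtype.ext (by
        change ρ ((a * b : P) : G) w.1 = ρ a (ρ b w.1); simp) }
  obtain ⟨w, hw⟩ := hP.nonempty_fixed_point_of_prime_not_dvd_card
    (Set.range fun g : G => ρ g v) h
  obtain ⟨g, hg⟩ := w.2
  refine ⟨w.1, fun h0 => hv ?_, fun x hx => congrArg Subtype.val (hw ⟨x, hx⟩)⟩
  have : ρ g⁻¹ (ρ g v) = 0 := by
    rw [show ρ g v = 0 from hg.trans h0, map_zero]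
  simpa using this

theorem alphaChar_eq_one_iff [Finite G] (ρ : Representation ℂ G V) :
    alphaChar ρ = 1 ↔ PSubgroupsFix ρ := by
  constructor
  · intro h p hp P hP
    by_contra hno
    refine hp.one_lt.ne' (Nat.dvd_one.1 (h ▸ dvd_alphaChar ρ fun v hv => ?_))
    by_contra hd
    exact hno (exists_fixed_of_not_dvd_orbitCard ρ hp P hP hv hd)
  · intro h
    by_contra hne
    obtain ⟨p, hp, hpd⟩ := Nat.exists_prime_and_dvd hne
    have := Fact.mk hp
    obtain ⟨P⟩ : Nonempty (Sylow p G) := inferInstance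
    obtain ⟨v, hv, hfix⟩ := h p hp P P.isPGroup'
    exact P.not_dvd_index
      ((hpd.trans (alphaChar_dvd_orbitCard ρ hv)).trans (orbitCard_dvd_index ρ P hfix))

end Characterization

section Irreducible

variable {G : Type*} [Group G] {V W : Type*} [AddCommGroup V] [Module ℂ V]
  [AddCommGroup W] [Module ℂ W]

theorem IsIrreducible.injective_of_ne_zero {ρ : Representation ℂ G V} (hρ : IsIrreducible ρ)
    (σ : Representation ℂ G W) (f : V →ₗ[ℂ] W) (hf : f ≠ 0)
    (hcomm : ∀ g v, f (ρ g v) = σ g (f v)) : Function.Injective f := by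
  rcases hρ.2 (LinearMap.ker f) (fun g v hv => by
    rw [LinearMap.mem_ker] at hv ⊢; rw [hcomm, hv, map_zero]) with h | h
  · exact LinearMap.ker_eq_bot.1 h
  · exact absurd (LinearMap.ker_eq_top.1 h) hf

theorem IsIrreducible.surjective_of_ne_zero {σ : Representation ℂ G W} (hσ : IsIrreducible σ)
    (ρ : Representation ℂ G V) (f : V →ₗ[ℂ] W) (hf : f ≠ 0)
    (hcomm : ∀ g v, f (ρ g v) = σ g (f v)) : Function.Surjective f := by
  rcases hσ.2 (LinearMap.range f) (by
    rintro g _ ⟨v, rfl⟩; exact ⟨ρ g v, hcomm g v⟩) with h | h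
  · exact absurd (LinearMap.range_eq_bot.1 h) hf
  · exact LinearMap.range_eq_top.1 h

theorem IsIrreducible.subRep_range {ρ : Representation ℂ G V} (hρ : IsIrreducible ρ)
    (σ : Representation ℂ G W) (f : V →ₗ[ℂ] W) (hf : Function.Injective f)
    (hcomm : ∀ g v, f (ρ g v) = σ g (f v))
    (hU : ∀ (g : G) (w : W), w ∈ LinearMap.range f → σ g w ∈ LinearMap.range f) :
    IsIrreducible (subRep σ (LinearMap.range f) hU) := by
  have := hρ.1
  refine ⟨(LinearEquiv.ofInjective f hf).symm.toEquiv.nontrivial, fun X hX => ?_⟩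
  rcases hρ.2 (X.comap f.rangeRestrict) (fun g v hv => by
    rw [Submodule.mem_comap] at hv ⊢
    rw [show f.rangeRestrict (ρ g v) = subRep σ _ hU g (f.rangeRestrict v) from
      Subtype.ext (hcomm g v)]
    exact hX g _ hv) with h | h
  · left
    rw [eq_bot_iff]
    rintro ⟨_, v, rfl⟩ hw
    have hv : v ∈ X.comap f.rangeRestrict := hw
    rw [h, Submodule.mem_bot] at hv
    simp [hv]
  · right
    rw [eq_top_iff]
    rintro ⟨_, v, rfl⟩ -
    have hv : v ∈ X.comap f.rangeRestrict := h ▸ Submodule.mem_top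
    exact hv

theorem PSubgroupsFix.subRep_range {ρ : Representation ℂ G V} (hρ : PSubgroupsFix ρ)
    (σ : Representation ℂ G W) (f : V →ₗ[ℂ] W) (hf : Function.Injective f)
    (hcomm : ∀ g v, f (ρ g v) = σ g (f v))
    (hU : ∀ (g : G) (w : W), w ∈ LinearMap.range f → σ g w ∈ LinearMap.range f) :
    PSubgroupsFix (subRep σ (LinearMap.range f) hU) := by
  intro p hp P hP
  obtain ⟨v, hv, hfix⟩ := hρ p hp P hP
  refine ⟨f.rangeRestrict v, fun h => hv (hf ?_), fun x hx => Subtype.ext ?_⟩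
  · rw [map_zero]
    exact congrArg Subtype.val h
  · exact (hcomm x v).symm.trans (congrArg f (hfix x hx))

/-- An invariant projector, up to the scalar `|G|`, onto an invariant subspace. -/
theorem exists_equivariant_scaled_projection [Finite G] (ρ : Representation ℂ G V)
    (U : Submodule ℂ V) (hU : ∀ (g : G) (v : V), v ∈ U → ρ g v ∈ U) :
    ∃ T : V →ₗ[ℂ] V, (∀ v, T v ∈ U) ∧ (∀ v ∈ U, T v = (Nat.card G : ℂ) • v) ∧
      ∀ g v, T (ρ g v) = ρ g (T v) := by
  classical
  have := Fintype.ofFinite G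
  obtain ⟨π, hπ⟩ := U.subtype.exists_leftInverse_of_injective (by simp)
  have hπ' : ∀ v (hv : v ∈ U), π v = ⟨v, hv⟩ := fun v hv => by
    simpa using LinearMap.congr_fun hπ ⟨v, hv⟩
  refine ⟨∑ g : G, ρ g ∘ₗ U.subtype ∘ₗ π ∘ₗ ρ g⁻¹, fun v => ?_, fun v hv => ?_, fun g v => ?_⟩
  · simp only [LinearMap.sum_apply]
    exact Submodule.sum_mem _ fun g _ => hU g _ (π (ρ g⁻¹ v)).2
  · have : ∀ g : G, (ρ g ∘ₗ U.subtype ∘ₗ π ∘ₗ ρ g⁻¹) v = v := fun g => by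
      simp [hπ' _ (hU g⁻¹ v hv)]
    simp only [LinearMap.sum_apply, this, Finset.sum_const, Finset.card_univ,
      Nat.card_eq_fintype_card, Nat.cast_smul_eq_nsmul]
  · simp only [LinearMap.sum_apply, map_sum]
    refine Fintype.sum_equiv (Equiv.mulLeft g⁻¹) _ _ fun h => ?_
    simp [map_mul]

/-- A nonzero vector fixed by `P` yields an irreducible subrepresentation containing one. -/
theorem exists_irreducible_subRep_fixed [Finite G] [FiniteDimensional ℂ V]
    (ρ : Representation ℂ G V) (P : Subgroup G) {v : V} (hv : v ≠ 0)
    (hfix : ∀ x ∈ P, ρ x v = v) :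
    ∃ (U : Submodule ℂ V) (hU : ∀ (g : G) (v : V), v ∈ U → ρ g v ∈ U),
      IsIrreducible (subRep ρ U hU) ∧ ∃ u ∈ U, u ≠ 0 ∧ ∀ x ∈ P, ρ x u = u := by
  obtain ⟨U, ⟨hU, u, huU, hu0, hufix⟩, hmin⟩ :=
    WellFounded.has_min (wellFounded_lt (α := Submodule ℂ V))
      {U | (∀ (g : G) (v : V), v ∈ U → ρ g v ∈ U) ∧ ∃ u ∈ U, u ≠ 0 ∧ ∀ x ∈ P, ρ x u = u}
      ⟨⊤, fun _ _ _ => Submodule.mem_top, v, Submodule.mem_top, hv, hfix⟩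
  refine ⟨U, hU, ⟨⟨⟨u, huU⟩, 0, fun h => hu0 (congrArg Subtype.val h)⟩, fun X hX => ?_⟩,
    u, huU, hu0, hufix⟩
  have hmem : ∀ w (hw : w ∈ U), w ∈ X.map U.subtype ↔ (⟨w, hw⟩ : U) ∈ X := by
    intro w hw
    simp [hw]
  have hle : X.map U.subtype ≤ U := Submodule.map_subtype_le U X
  have hinv : ∀ (g : G) (w : V), w ∈ X.map U.subtype → ρ g w ∈ X.map U.subtype := by
    rintro g _ ⟨w, hw, rfl⟩
    exact ⟨_, hX g w hw, rfl⟩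
  obtain ⟨T, hTmem, hTsmul, hTcomm⟩ := exists_equivariant_scaled_projection ρ _ hinv
  by_cases hTu : T u = 0
  · left
    rw [eq_bot_iff]
    intro w hw
    have hw' : (w : V) ∈ X.map U.subtype := ⟨w, hw, rfl⟩
    have hK : ¬ U ⊓ LinearMap.ker T < U := hmin _
      ⟨fun g z hz => ⟨hU g z hz.1, by
        have := hz.2
        simp only [SetLike.mem_coe, LinearMap.mem_ker] at this ⊢
        rw [hTcomm, this, map_zero]⟩, u, ⟨huU, hTu⟩, hu0, hufix⟩
    have hwT : T w = 0 :=
      (inf_eq_left.1 (eq_of_le_of_not_lt inf_le_left hK)) w.2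
    rw [hTsmul _ hw'] at hwT
    have hc : (Nat.card G : ℂ) ≠ 0 := Nat.cast_ne_zero.2 Nat.card_pos.ne'
    simpa [hc] using hwT
  · right
    have hK : ¬ X.map U.subtype < U := hmin _
      ⟨hinv, T u, hTmem u, hTu, fun x hx => by rw [← hTcomm, hufix x hx]⟩
    have heq := eq_of_le_of_not_lt hle hK
    rw [eq_top_iff]
    rintro ⟨w, hw⟩ -
    exact (hmem w hw).1 (heq.symm ▸ hw)

end Irreducible

section Induced

variable {G : Type*} [Group G] (N : Subgroup G) {W : Type*} [AddCommGroup W] [Module ℂ W]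

/-- Evaluation at the identity of an induced representation. -/
def inducedEval (ω : Representation ℂ ↥N W) : ↥(inducedSpace N ω) →ₗ[ℂ] W :=
  LinearMap.proj 1 ∘ₗ (inducedSpace N ω).subtype

theorem inducedEval_apply (ω : Representation ℂ ↥N W) (f : ↥(inducedSpace N ω)) :
    inducedEval N ω f = f.1 1 := rfl

theorem inducedRep_apply_coe (ω : Representation ℂ ↥N W) (g x : G)
    (f : ↥(inducedSpace N ω)) : (inducedRep N ω g f).1 x = f.1 (g⁻¹ * x) := rfl

theorem inducedEval_equivariant (ω : Representation ℂ ↥N W) (n : N)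
    (f : ↥(inducedSpace N ω)) :
    inducedEval N ω (inducedRep N ω n f) = ω n (inducedEval N ω f) := by
  have := f.2 1 n⁻¹
  simpa [inducedEval_apply, inducedRep_apply_coe] using this

theorem exists_inducedEval_ne_zero (ω : Representation ℂ ↥N W) {f : ↥(inducedSpace N ω)}
    (hf : f ≠ 0) : ∃ g : G, inducedEval N ω (inducedRep N ω g f) ≠ 0 := by
  by_contra! h
  refine hf (Subtype.ext (funext fun x => ?_))
  simpa [inducedEval_apply, inducedRep_apply_coe] using h x⁻¹

open Classical in
/-- The element of the induced representation supported on `N` with value `w` at `1`. -/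
noncomputable def inducedSingle (ω : Representation ℂ ↥N W) (w : W) : ↥(inducedSpace N ω) :=
  ⟨fun g => if h : g ∈ N then ω ⟨g, h⟩⁻¹ w else 0, by
    intro g n
    by_cases h : g ∈ N
    · have h' : g * n ∈ N := N.mul_mem h n.2
      simp only [h, h', dif_pos]
      rw [← Module.End.mul_apply, ← map_mul]
      congr 2
      ext
      simp
    · have h' : g * n ∉ N := fun h' => h ((N.mul_mem_cancel_right n.2).1 h')
      simp [h, h']⟩

theorem exists_fixed_inducedRep [Finite G] (ω : Representation ℂ ↥N W) (P : Subgroup G)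
    {w : W} (hw : w ≠ 0) (hfix : ∀ x ∈ P.subgroupOf N, ω x w = w) :
    ∃ f : ↥(inducedSpace N ω), f ≠ 0 ∧ ∀ x ∈ P, inducedRep N ω x f = f := by
  classical
  have := Fintype.ofFinite P
  refine ⟨∑ x : P, inducedRep N ω x (inducedSingle N ω w), fun h0 => ?_, fun y hy => ?_⟩
  · have h1 := congrArg (inducedEval N ω) h0
    have h2 : ∀ x : P, inducedEval N ω (inducedRep N ω x (inducedSingle N ω w)) =
        if (x : G) ∈ N then w else 0 := by
      intro x
      by_cases hx : (x : G) ∈ N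
      · have := hfix ⟨x, hx⟩ (Subgroup.mem_subgroupOf.2 x.2)
        have hinv : (⟨(x : G)⁻¹, N.inv_mem hx⟩ : N)⁻¹ = ⟨x, hx⟩ := Subtype.ext (inv_inv _)
        rw [if_pos hx]
        simpa [inducedEval_apply, inducedRep_apply_coe, inducedSingle, hx, hinv] using this
      · simp [inducedEval_apply, inducedRep_apply_coe, inducedSingle, hx]
    rw [map_sum, map_zero, Finset.sum_congr rfl fun x _ => h2 x, ← Finset.sum_filter,
      Finset.sum_const, ← Nat.cast_smul_eq_nsmul ℂ] at h1
    rcases smul_eq_zero.1 h1 with h | h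
    · rw [Nat.cast_eq_zero, Finset.card_eq_zero] at h
      exact Finset.notMem_empty (1 : P) (h ▸ by simp)
    · exact hw h
  · rw [map_sum]
    refine Fintype.sum_equiv (Equiv.mulLeft (⟨y, hy⟩ : P)) _ _ fun x => ?_
    simp

theorem exists_component_of_prime_index [Finite G] [N.Normal] {p : ℕ} (hp : p.Prime)
    (hindex : N.index = p) [FiniteDimensional ℂ W] (ω : Representation ℂ ↥N W)
    (hirr : IsIrreducible ω) (hω : PSubgroupsFix ω) :
    ∃ (U : Submodule ℂ ↥(inducedSpace N ω))
      (hU : ∀ (g : G) (v : ↥(inducedSpace N ω)), v ∈ U → inducedRep N ω g v ∈ U),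
      IsIrreducible (subRep (inducedRep N ω) U hU) ∧
        PSubgroupsFix (subRep (inducedRep N ω) U hU) ∧
        inducedEval N ω ∘ₗ U.subtype ≠ 0 := by
  classical
  have := Fact.mk hp
  obtain ⟨P⟩ : Nonempty (Sylow p G) := inferInstance
  obtain ⟨w, hw, hwfix⟩ := hω p hp (P.1.subgroupOf N)
    (P.isPGroup'.comap_of_injective N.subtype N.subtype_injective)
  obtain ⟨f, hf, hffix⟩ := exists_fixed_inducedRep N ω P.1 hw hwfix
  obtain ⟨U, hU, hUirr, u, huU, hu, hufix⟩ :=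
    exists_irreducible_subRep_fixed (inducedRep N ω) P.1 hf hffix
  have hne : inducedEval N ω ∘ₗ U.subtype ≠ 0 := fun h0 => by
    obtain ⟨g, hg⟩ := exists_inducedEval_ne_zero N ω hu
    exact hg (LinearMap.congr_fun h0 ⟨_, hU g u huU⟩)
  refine ⟨U, hU, hUirr, fun q hq Q hQ => ?_, hne⟩
  have := Fact.mk hq
  by_cases hqp : q = p
  · subst hqp
    obtain ⟨R, hR⟩ := hQ.exists_le_sylow
    obtain ⟨g, rfl⟩ := MulAction.exists_smul_eq G P R
    refine ⟨⟨inducedRep N ω g u, hU g u huU⟩, fun h0 => hu ?_, fun x hx => Subtype.ext ?_⟩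
    · have := congrArg (inducedRep N ω g⁻¹) (congrArg Subtype.val h0)
      simpa using this
    · have hx' : g⁻¹ * x * g ∈ P.1 := by
        have := hR hx
        rw [Sylow.smul_def, Sylow.pointwise_smul_def,
          Subgroup.mem_pointwise_smul_iff_inv_smul_mem] at this
        simpa [MulAut.smul_def, ← map_inv] using this
      change inducedRep N ω x (inducedRep N ω g u) = inducedRep N ω g u
      conv_rhs => rw [← hufix _ hx']
      simp only [← Module.End.mul_apply, ← map_mul]
      congr 2
      group
  · have hQN : Q ≤ N := by
      intro x hx
      obtain ⟨k, hk⟩ := hQ ⟨x, hx⟩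
      have hxk : x ^ q ^ k = 1 := congrArg Subtype.val hk
      rw [← QuotientGroup.eq_one_iff, ← orderOf_eq_one_iff]
      have h1 : orderOf (x : G ⧸ N) ∣ q ^ k := orderOf_dvd_of_pow_eq_one (by
        rw [← QuotientGroup.mk_pow, hxk, QuotientGroup.mk_one])
      have h2 : orderOf (x : G ⧸ N) ∣ p := by
        rw [← hindex]; exact orderOf_dvd_natCard _
      exact Nat.eq_one_of_dvd_coprimes
        (((Nat.coprime_primes hq hp).2 hqp).pow_left k) h1 h2
    obtain ⟨z, hz, hzfix⟩ := hω q hq (Q.subgroupOf N)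
      (hQ.comap_of_injective N.subtype N.subtype_injective)
    obtain ⟨y, rfl⟩ := hirr.surjective_of_ne_zero ((subRep (inducedRep N ω) U hU).comp N.subtype)
      _ hne (fun n (v : U) => inducedEval_equivariant N ω n v.1) z
    have := Fintype.ofFinite Q
    refine ⟨∑ x : Q, subRep (inducedRep N ω) U hU x y, fun h0 => ?_, fun x hx => ?_⟩
    · have h1 := congrArg (inducedEval N ω ∘ₗ U.subtype) h0
      have h2 : ∀ x : Q, (inducedEval N ω ∘ₗ U.subtype) (subRep (inducedRep N ω) U hU x y) =
          (inducedEval N ω ∘ₗ U.subtype) y := fun x =>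
        (inducedEval_equivariant N ω ⟨x, hQN x.2⟩ y.1).trans
          (hzfix ⟨x, hQN x.2⟩ (Subgroup.mem_subgroupOf.2 x.2))
      rw [map_sum, map_zero, Finset.sum_congr rfl fun x _ => h2 x, Finset.sum_const,
        ← Nat.cast_smul_eq_nsmul ℂ] at h1
      rcases smul_eq_zero.1 h1 with h | h
      · rw [Nat.cast_eq_zero, Finset.card_eq_zero] at h
        exact Finset.notMem_empty (1 : Q) (h ▸ Finset.mem_univ _)
      · exact hz h
    · rw [map_sum]
      refine Fintype.sum_equiv (Equiv.mulLeft (⟨x, hx⟩ : Q)) _ _ fun z => ?_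
      simp

end Induced

/-- A proper kernel of a homomorphism to a solvable group lies in a normal subgroup of
prime index. -/
theorem exists_normal_prime_index_ker_le {G S : Type*} [Group G] [Finite G] [Group S]
    [Group.IsSolvable S] (q : G →* S) (hq : q.ker ≠ ⊤) :
    ∃ M : Subgroup G, M.Normal ∧ M.index.Prime ∧ q.ker ≤ M := by
  have hne : q.ker ⊔ commutator G ≠ ⊤ := by
    intro h
    have hr : q.range ≠ ⊥ := fun h => hq (by
      rw [MonoidHom.range_eq_map, Subgroup.map_eq_bot_iff] at h
      exact top_le_iff.1 h)
    have h1 := congrArg (Subgroup.map q) h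
    rw [Subgroup.map_sup, commutator_def, Subgroup.map_commutator, ← MonoidHom.range_eq_map,
      (Subgroup.map_eq_bot_iff _).2 le_rfl, bot_sup_eq] at h1
    exact (Group.IsSolvable.commutator_lt_of_ne_bot hr).ne h1
  obtain ⟨M, hM, hle⟩ := (eq_top_or_exists_le_coatom (q.ker ⊔ commutator G)).resolve_left hne
  have hcomm : commutator G ≤ M := le_sup_right.trans hle
  have hnormal : M.Normal := Subgroup.Normal.of_commutator_le _ hcomm
  refine ⟨M, hnormal, ?_, le_sup_left.trans hle⟩
  have : IsMulCommutative (G ⧸ M) :=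
    Subgroup.Normal.quotient_commutative_iff_commutator_le.2 hcomm
  have : Nontrivial (G ⧸ M) := QuotientGroup.nontrivial_iff.2 hM.1
  have : IsSimpleGroup (G ⧸ M) := ⟨fun H _ => by
    have hMH : M ≤ H.comap (QuotientGroup.mk' M) := fun x hx => by
      rw [Subgroup.mem_comap, QuotientGroup.mk'_apply, (QuotientGroup.eq_one_iff x).2 hx]
      exact H.one_mem
    have hmap := Subgroup.map_comap_eq_self_of_surjective (QuotientGroup.mk'_surjective M) H
    rcases hM.le_iff.1 hMH with h | h
    · exact Or.inr (by
        rw [← hmap, h, Subgroup.map_top_of_surjective _ (QuotientGroup.mk'_surjective M)])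
    · exact Or.inl (by rw [← hmap, h, QuotientGroup.map_mk'_self])⟩
  exact Group.is_simple_iff_prime_card.1 this

/-- If the cokernel of `i : K → G` is solvable and all subgroups of prime power order fix nonzero
vectors in `ω`, then `ω` is a quotient of the restriction along `i` of an irreducible
representation of `G` with the same property. -/
theorem exists_irreducible_over {K S : Type} [Group K] [Group S] [Group.IsSolvable S]
    {W : Type} [AddCommGroup W] [Module ℂ W] [FiniteDimensional ℂ W]
    (ω : Representation ℂ K W) (hirr : IsIrreducible ω) (hω : PSubgroupsFix ω)
    (n : ℕ) {G : Type} [Group G] [Finite G] (hn : Nat.card G = n)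
    (i : K →* G) (hi : Function.Injective i) (q : G →* S) (hiq : i.range = q.ker) :
    ∃ (V : Type) (_ : AddCommGroup V) (_ : Module ℂ V) (_ : FiniteDimensional ℂ V)
      (ρ : Representation ℂ G V) (π : V →ₗ[ℂ] W),
      IsIrreducible ρ ∧ PSubgroupsFix ρ ∧ π ≠ 0 ∧ ∀ k v, π (ρ (i k) v) = ω k (π v) := by
  induction n using Nat.strong_induction_on generalizing G with
  | _ n ih =>
  by_cases hker : q.ker = ⊤
  · let e : K ≃* G := MulEquiv.ofBijective i ⟨hi, MonoidHom.range_eq_top.1 (hiq.trans hker)⟩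
    have he : ∀ k, e.symm (i k) = k := fun k => e.symm_apply_apply k
    have := hirr.1
    refine ⟨W, _, _, ‹_›, ω.comp e.symm.toMonoidHom, LinearMap.id, ⟨hirr.1, fun U hU => ?_⟩,
      fun p hp P hP => ?_, ?_, fun k v => ?_⟩
    · exact hirr.2 U fun k v hv => by simpa [he] using hU (i k) v hv
    · obtain ⟨v, hv, hfix⟩ := hω p hp (P.comap i) (hP.comap_of_injective i hi)
      refine ⟨v, hv, fun x hx => ?_⟩
      obtain ⟨k, rfl⟩ := e.surjective x
      simpa using hfix k hx
    · exact fun h => not_subsingleton W ⟨fun a b =>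
        (LinearMap.congr_fun h a).trans (LinearMap.congr_fun h b).symm⟩
    · simp [he]
  · obtain ⟨M, hMnormal, hMprime, hMle⟩ := exists_normal_prime_index_ker_le q hker
    have hiM : ∀ k, i k ∈ M := fun k => hMle (hiq ▸ ⟨k, rfl⟩)
    have hlt : Nat.card M < n := by
      rw [← hn, ← M.card_mul_index]
      exact lt_mul_of_one_lt_right Nat.card_pos hMprime.one_lt
    obtain ⟨V, _, _, _, σ, π, hσ, hσfix, hπ, hcomm⟩ := ih _ hlt rfl (i.codRestrict M hiM)
      (fun a b h => hi (congrArg Subtype.val h)) (q.comp M.subtype) (by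
        ext ⟨x, hx⟩
        have : x ∈ i.range ↔ x ∈ q.ker := by rw [hiq]
        simpa [MonoidHom.mem_ker, Subtype.ext_iff] using this)
    obtain ⟨U, hU, hUirr, hUfix, hne⟩ :=
      exists_component_of_prime_index M hMprime rfl σ hσ hσfix
    have hsurj := hσ.surjective_of_ne_zero
      ((subRep (inducedRep M σ) U hU).comp M.subtype) _ hne
      (fun n (v : U) => inducedEval_equivariant M σ n v.1)
    refine ⟨U, inferInstance, inferInstance, inferInstance, subRep (inducedRep M σ) U hU,
      π ∘ₗ inducedEval M σ ∘ₗ U.subtype, hUirr, hUfix, fun h0 => hπ ?_, fun k v => ?_⟩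
    · ext v
      obtain ⟨u, rfl⟩ := hsurj v
      exact LinearMap.congr_fun h0 u
    · exact (congrArg π (inducedEval_equivariant M σ ⟨i k, hiM k⟩ v.1)).trans (hcomm k _)

/-- Frobenius reciprocity: the map to the induced representation attached to an
`N`-equivariant map. -/
def toInduced {G : Type*} [Group G] (N : Subgroup G) {V W : Type*} [AddCommGroup V]
    [Module ℂ V] [AddCommGroup W] [Module ℂ W] (ρ : Representation ℂ G V)
    (ω : Representation ℂ ↥N W) (π : V →ₗ[ℂ] W)
    (hπ : ∀ (n : N) v, π (ρ n v) = ω n (π v)) : V →ₗ[ℂ] ↥(inducedSpace N ω) where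
  toFun v := ⟨fun g => π (ρ g⁻¹ v), fun g n => by
    have := hπ n⁻¹ (ρ g⁻¹ v)
    simpa using this⟩
  map_add' _ _ := by ext; simp
  map_smul' _ _ := by ext; simp

theorem toInduced_equivariant {G : Type*} [Group G] (N : Subgroup G) {V W : Type*}
    [AddCommGroup V] [Module ℂ V] [AddCommGroup W] [Module ℂ W] (ρ : Representation ℂ G V)
    (ω : Representation ℂ ↥N W) (π : V →ₗ[ℂ] W)
    (hπ : ∀ (n : N) v, π (ρ n v) = ω n (π v)) (g : G) (v : V) :
    toInduced N ρ ω π hπ (ρ g v) = inducedRep N ω g (toInduced N ρ ω π hπ v) := by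
  ext x
  simp [toInduced, inducedRep]

end AlphaChar

open AlphaChar

set_option synthInstance.maxHeartbeats 1000000 in
/-- if N ⊴ G with G/N solvable and ω is an irreducible N-representation
with α(ω) = 1, then the induced representation ω^G admits an irreducible component
(an invariant subspace on which the restricted representation is irreducible)
with α-characteristic 1. -/
theorem induced_has_component_alphaChar_one {G : Type} [Group G] [Finite G]
    (N : Subgroup G) [N.Normal] (hsolv : IsSolvable (G ⧸ N))
    {W : Type} [AddCommGroup W] [Module ℂ W] [FiniteDimensional ℂ W]
    (ω : Representation ℂ ↥N W) (hirr : AlphaChar.IsIrreducible ω) (hω : alphaChar ω = 1) :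
    ∃ (U : Submodule ℂ ↥(inducedSpace N ω))
      (hU : ∀ (g : G) (v : ↥(inducedSpace N ω)), v ∈ U → inducedRep N ω g v ∈ U),
      AlphaChar.IsIrreducible (subRep (inducedRep N ω) U hU) ∧
        alphaChar (subRep (inducedRep N ω) U hU) = 1 := by
  have : Group.IsSolvable (G ⧸ N) := hsolv
  obtain ⟨V, _, _, _, ρ, π, hρ, hfix, hπ, hcomm⟩ :=
    exists_irreducible_over ω hirr ((alphaChar_eq_one_iff ω).1 hω) _ rfl
      N.subtype N.subtype_injective (QuotientGroup.mk' N) (by simp)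
  let T := toInduced N ρ ω π hcomm
  have hT : ∀ g v, T (ρ g v) = inducedRep N ω g (T v) := toInduced_equivariant N ρ ω π hcomm
  have hT0 : T ≠ 0 := fun h0 => hπ (LinearMap.ext fun v => by
    have := congrFun (congrArg Subtype.val (LinearMap.congr_fun h0 v)) 1
    simpa [T, toInduced] using this)
  have hinj := hρ.injective_of_ne_zero _ T hT0 hT
  have hU : ∀ (g : G) (v : ↥(inducedSpace N ω)), v ∈ LinearMap.range T →
      inducedRep N ω g v ∈ LinearMap.range T := by
    rintro g _ ⟨v, rfl⟩
    exact ⟨ρ g v, hT g v⟩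
  exact ⟨LinearMap.range T, hU, hρ.subRep_range _ T hinj hT hU,
    (alphaChar_eq_one_iff _).2 (hfix.subRep_range _ T hinj hT hU)⟩
end

section
/- Call a finite group G totally α-trivial if every irreducible finite-dimensional complex representation ρ of G satisfies α(ρ) = 1. Then: (a) if G is totally α-trivial and N is a normal subgroup of G, then both N and the quotient G/N are totally α-trivial; (b) if G and H are both totally α-trivial, then the direct product G × H is totally α-trivial. -/
namespace AlphaChar

/-- A finite group is totally α-trivial if every irreducible finite-dimensional complex
representation has α-characteristic equal to 1. -/
def TotallyAlphaTrivial (G : Type) [Group G] [Finite G] : Prop :=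
  ∀ (V : Type) [AddCommGroup V] [Module ℂ V] [FiniteDimensional ℂ V]
    (ρ : Representation ℂ G V), IsIrreducible ρ → alphaChar ρ = 1

/-- The subgroup of elements fixing the vector `v`. -/
def vectorStabilizer {G : Type*} [Group G] {V : Type*} [AddCommMonoid V] [Module ℂ V]
    (ρ : Representation ℂ G V) (v : V) : Subgroup G :=
  letI : MulAction G V := MulAction.compHom V ρ
  MulAction.stabilizer G v

section Stabilizer

variable {G : Type*} [Group G] {V : Type*} [AddCommMonoid V] [Module ℂ V]

theorem mem_vectorStabilizer {ρ : Representation ℂ G V} {v : V} {g : G} :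
    g ∈ vectorStabilizer ρ v ↔ ρ g v = v := Iff.rfl

theorem index_vectorStabilizer (ρ : Representation ℂ G V) (v : V) :
    (vectorStabilizer ρ v).index = orbitCard ρ v :=
  letI : MulAction G V := MulAction.compHom V ρ
  MulAction.index_stabilizer G v

theorem dvd_alphaChar_iff [Finite G] (ρ : Representation ℂ G V) (d : ℕ) :
    d ∣ alphaChar ρ ↔ ∀ v : V, v ≠ 0 → d ∣ (vectorStabilizer ρ v).index := by
  classical
  rw [alphaChar, Finset.dvd_gcd_iff]
  constructor
  · intro h v hv
    rw [index_vectorStabilizer]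
    refine h _ (Finset.mem_filter.2 ⟨?_, v, hv, rfl⟩)
    change orbitCard ρ v ∈ _
    rw [Finset.mem_range, Nat.lt_succ_iff, ← index_vectorStabilizer]
    exact Nat.le_of_dvd Nat.card_pos (Subgroup.index_dvd_card _)
  · intro h n hn
    obtain ⟨-, v, hv, rfl⟩ := Finset.mem_filter.1 hn
    rw [id, ← index_vectorStabilizer]
    exact h v hv

theorem alphaChar_eq_one_iff_s16 [Finite G] (ρ : Representation ℂ G V) :
    alphaChar ρ = 1 ↔
      ∀ p : ℕ, p.Prime → ∃ v : V, v ≠ 0 ∧ ¬ p ∣ (vectorStabilizer ρ v).index := by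
  simp only [Nat.eq_one_iff_not_exists_prime_dvd, dvd_alphaChar_iff, not_forall, exists_prop]

end Stabilizer

theorem TotallyAlphaTrivial.alphaChar_eq_one {G : Type} [Group G] [Finite G]
    (hG : TotallyAlphaTrivial G) {V : Type} [AddCommGroup V] [Module ℂ V]
    [FiniteDimensional ℂ V] [Nontrivial V] (ρ : Representation ℂ G V) : alphaChar ρ = 1 := by
  induction h : Module.finrank ℂ V using Nat.strong_induction_on generalizing V with
  | _ n ih =>
  subst h
  by_cases hρ : IsIrreducible ρ
  · exact hG V ρ hρ
  obtain ⟨U, hU, hbot, htop⟩ : ∃ U : Submodule ℂ V,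
      (∀ (g : G) (v : V), v ∈ U → ρ g v ∈ U) ∧ U ≠ ⊥ ∧ U ≠ ⊤ := by
    by_contra! hcon
    exact hρ ⟨inferInstance, fun U hU => or_iff_not_imp_left.2 (hcon U hU)⟩
  have : Nontrivial U := Submodule.nontrivial_iff_ne_bot.2 hbot
  have hsub := ih _ (Submodule.finrank_lt htop) (ρ.subrepresentation U fun g v => hU g v) rfl
  refine Nat.dvd_one.1 (hsub ▸ (dvd_alphaChar_iff _ _).2 fun v hv => ?_)
  have hdvd := (dvd_alphaChar_iff ρ _).1 dvd_rfl (v : V) (by simpa using hv)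
  refine hdvd.trans (Subgroup.index_dvd_of_le fun g hg => ?_)
  exact congrArg Subtype.val (mem_vectorStabilizer.1 hg)

theorem TotallyAlphaTrivial.of_surjective {G Q : Type} [Group G] [Finite G] [Group Q] [Finite Q]
    (hG : TotallyAlphaTrivial G) (f : G →* Q) (hf : Function.Surjective f) :
    TotallyAlphaTrivial Q := by
  intro V _ _ _ ρ hρ
  have := hρ.1
  refine Nat.dvd_one.1 (hG.alphaChar_eq_one (ρ.comp f) ▸ (dvd_alphaChar_iff _ _).2 fun v hv => ?_)
  have hcomap : vectorStabilizer (ρ.comp f) v = (vectorStabilizer ρ v).comap f := rfl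
  rw [hcomap, Subgroup.index_comap_of_surjective _ hf]
  exact (dvd_alphaChar_iff ρ _).1 dvd_rfl v hv

theorem relIndex_dvd_index_of_normal_right {G : Type*} [Group G] [Finite G] (H N : Subgroup G)
    [N.Normal] : H.relIndex N ∣ H.index := by
  obtain ⟨c, hc⟩ := Subgroup.relIndex_dvd_index_of_normal N H
  have h₁ := Subgroup.relIndex_mul_index (inf_le_left : H ⊓ N ≤ H)
  have h₂ := Subgroup.relIndex_mul_index (inf_le_right : H ⊓ N ≤ N)
  rw [Subgroup.inf_relIndex_left] at h₁
  rw [Subgroup.inf_relIndex_right, hc] at h₂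
  have hpos : 0 < N.relIndex H :=
    Nat.pos_of_ne_zero (Subgroup.index_ne_zero_of_finite (H := N.subgroupOf H))
  exact ⟨c, Nat.eq_of_mul_eq_mul_left hpos (by rw [h₁, ← h₂]; ring)⟩

theorem nontrivial_coindV {k G A : Type*} [Semiring k] [Group G] [AddCommMonoid A] [Module k A]
    [Nontrivial A] (N : Subgroup G) (σ : Representation k N A) :
    Nontrivial (Representation.coindV N.subtype σ) := by
  classical
  obtain ⟨w, hw⟩ := exists_ne (0 : A)
  let f : G → A := fun x => if h : x ∈ N then σ ⟨x, h⟩ w else 0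
  have hf : f ∈ Representation.coindV N.subtype σ := by
    intro n x
    by_cases hx : x ∈ N
    · have hnx : (n : G) * x ∈ N := N.mul_mem n.2 hx
      have hmul : (⟨n * x, hnx⟩ : N) = n * ⟨x, hx⟩ := rfl
      simp only [f, N.subtype_apply, dif_pos hx, dif_pos hnx, hmul, map_mul,
        Module.End.mul_apply]
    · simp [f, hx, N.mul_mem_cancel_left n.2]
  refine nontrivial_of_ne ⟨f, hf⟩ 0 fun h => hw ?_
  have h1 := congrFun (congrArg Subtype.val h) 1
  have hone : (⟨1, N.one_mem⟩ : N) = 1 := rfl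
  simpa [f, N.one_mem, hone] using h1

theorem TotallyAlphaTrivial.of_normal {G : Type} [Group G] [Finite G]
    (hG : TotallyAlphaTrivial G) (N : Subgroup G) [hN : N.Normal] : TotallyAlphaTrivial N := by
  intro W _ _ _ σ hσ
  have := hσ.1
  have := nontrivial_coindV N σ
  refine Nat.dvd_one.1 (hG.alphaChar_eq_one (Representation.coind N.subtype σ) ▸
    (dvd_alphaChar_iff _ _).2 fun f hf => ?_)
  obtain ⟨x, hx⟩ : ∃ x, f.1 x ≠ 0 := by
    by_contra! h
    exact hf (Subtype.ext (funext h))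
  let S := vectorStabilizer (Representation.coind N.subtype σ) f
  have hle : (S.map (MulAut.conj x).toMonoidHom).subgroupOf N ≤ vectorStabilizer σ (f.1 x) := by
    intro n hn
    obtain ⟨s, hs, hsn⟩ := Subgroup.mem_map.1 (Subgroup.mem_subgroupOf.1 hn)
    have hsn' : (n : G) * x = x * s := by
      rw [← hsn]
      simp
    have hfix : f.1 (x * s) = f.1 x := congrFun (congrArg Subtype.val hs) x
    rw [mem_vectorStabilizer, ← f.2 n x, N.subtype_apply, hsn', hfix]
  have hindex : (S.map (MulAut.conj x).toMonoidHom).index = S.index :=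
    Subgroup.index_map_equiv S (MulAut.conj x)
  calc alphaChar σ ∣ (vectorStabilizer σ (f.1 x)).index := (dvd_alphaChar_iff σ _).1 dvd_rfl _ hx
    _ ∣ (S.map (MulAut.conj x).toMonoidHom).relIndex N := Subgroup.index_dvd_of_le hle
    _ ∣ (S.map (MulAut.conj x).toMonoidHom).index := relIndex_dvd_index_of_normal_right _ N
    _ ∣ S.index := hindex.dvd

theorem TotallyAlphaTrivial.prod {G H : Type} [Group G] [Finite G] [Group H] [Finite H]
    (hG : TotallyAlphaTrivial G) (hH : TotallyAlphaTrivial H) : TotallyAlphaTrivial (G × H) := by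
  intro V _ _ _ ρ hρ
  have := hρ.1
  refine (alphaChar_eq_one_iff_s16 ρ).2 fun p hp => ?_
  let ρG : Representation ℂ G V := ρ.comp (MonoidHom.inl G H)
  let ρH : Representation ℂ H V := ρ.comp (MonoidHom.inr G H)
  obtain ⟨v, hv, hvp⟩ := (alphaChar_eq_one_iff_s16 ρG).1 (hG.alphaChar_eq_one ρG) p hp
  let S := vectorStabilizer ρG v
  let U : Submodule ℂ V := ⨅ s : S, LinearMap.eqLocus (ρG s) 1
  have mem_U {u : V} : u ∈ U ↔ ∀ s ∈ S, ρG s u = u := by simp [U]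
  have hcomm (g : G) (h : H) (u : V) : ρG g (ρH h u) = ρH h (ρG g u) := by
    change (ρ (g, 1) * ρ (1, h)) u = (ρ (1, h) * ρ (g, 1)) u
    simp [← map_mul]
  have hU (h : H) : U ≤ U.comap (ρH h) := fun u hu =>
    mem_U.2 fun s hs => by rw [hcomm, mem_U.1 hu s hs]
  have : Nontrivial U := Submodule.nontrivial_iff_ne_bot.2 <|
    (Submodule.ne_bot_iff U).2 ⟨v, mem_U.2 fun s hs => hs, hv⟩
  let ρU := ρH.subrepresentation U hU
  obtain ⟨u, hu, hup⟩ := (alphaChar_eq_one_iff_s16 ρU).1 (hH.alphaChar_eq_one ρU) p hp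
  refine ⟨u, by simpa using hu, fun hdvd => ?_⟩
  have hle : S.prod (vectorStabilizer ρU u) ≤ vectorStabilizer ρ (u : V) := by
    rintro ⟨g, h⟩ ⟨hg, hh⟩
    have hgu : ρ (g, 1) u = u := mem_U.1 u.2 g hg
    have hhu : ρ (1, h) u = u := congrArg Subtype.val hh
    have hgh : ((g, h) : G × H) = (g, 1) * (1, h) := by simp
    rw [mem_vectorStabilizer, hgh, map_mul, Module.End.mul_apply, hhu, hgu]
  have hprod := hdvd.trans (Subgroup.index_dvd_of_le hle)
  rw [Subgroup.index_prod] at hprod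
  exact (hp.dvd_mul.1 hprod).elim hvp hup

end AlphaChar

open AlphaChar in
/-- (a) total α-triviality passes to normal subgroups and quotients;
(b) it is preserved by direct products. -/
theorem totallyAlphaTrivial_closure (G H : Type) [Group G] [Finite G] [Group H] [Finite H] :
    (TotallyAlphaTrivial G →
      ∀ (N : Subgroup G) [N.Normal],
        TotallyAlphaTrivial ↥N ∧ TotallyAlphaTrivial (G ⧸ N)) ∧
    (TotallyAlphaTrivial G → TotallyAlphaTrivial H → TotallyAlphaTrivial (G × H)) :=
  ⟨fun hG N _ => ⟨hG.of_normal N, hG.of_surjective (QuotientGroup.mk' N)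
    (QuotientGroup.mk'_surjective N)⟩, TotallyAlphaTrivial.prod⟩
end
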